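/- (Outer-loop convergence of the Double Inexact Proximal Point Algorithm, DIPPA.) Let g, h be differentiable, L-smooth and μ-strongly convex with 0 < μ ≤ L, A : ℝ^{d_y} → ℝ^{d_x} linear, (x*, y*) the saddle point of f(x,y) = g(x) + ⟨x, Ay⟩ − h(y). Set α = 1/√(Lμ), κ = L/μ, ρ = 1/(2√κ), C₀ = ‖x₀ − x*‖² + ‖y₀ − y*‖², ε_k = (C₀μ/16)(1 − ρ)^{k+1}, δ_k = C₀Lμ(1 − ρ)^{k+1}/(2(1 + √κ)(Lμ + ‖A‖²)), and C = 4√κ + 1 + ‖A‖²/(Lμ). Suppose the iterates satisfy, for each k ≥ 1: z_k = x_{k−1} − αAy_{k−1}; w_k = y_{k−1} + αA^T x_{k−1}; G_k(x̃_k) − min_x G_k(x) ≤ ε_k where G_k(x) = g(x) + (1/(2α))‖x − z_k‖²; H_k(ỹ_k) − min_y H_k(y) ≤ ε_k where H_k(y) = h(y) + (1/(2α))‖y − w_k‖²; and ‖x_k − x_k*‖² + ‖y_k − y_k*‖² ≤ δ_k, where (x_k*, y_k*) is the exact saddle point of the quadratic subproblem (x, y) ↦ (1/(2α))‖x − 2x̃_k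 + z_k‖² + ⟨x, Ay⟩ − (1/(2α))‖y − 2ỹ_k + w_k‖², i.e. x_k* + αAy_k* = 2x̃_k − z_k and y_k* − αA^T x_k* = 2ỹ_k − w_k. Then for every K ≥ 1: ‖x_K − x*‖² + ‖y_K − y*‖² ≤ C·(1 − ρ)^K·C₀. -/

import Mathlib

open scoped RealInnerProductSpace

section SmoothStronglyConvex

variable {E : Type*} [NormedAddCommGroup E] [InnerProductSpace ℝ E] [CompleteSpace E]
  {g : E → ℝ} {g' : E → E} {L μ : ℝ}

/-- The descent lemma: a function with `L`-Lipschitz gradient lies below its quadratic model. -/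
lemma le_quadratic_of_lipschitz_gradient (hdiff : ∀ u, HasGradientAt g (g' u) u)
    (hsmooth : ∀ u v, ‖g' u - g' v‖ ≤ L * ‖u - v‖) (u v : E) :
    g v ≤ g u + ⟪g' u, v - u⟫ + L / 2 * ‖v - u‖ ^ 2 := by
  set d := v - u with hd
  let F : ℝ → ℝ := fun t ↦ g (u + t • d) - t * ⟪g' u, d⟫ - L / 2 * t ^ 2 * ‖d‖ ^ 2
  have hF : ∀ t, HasDerivAt F (⟪g' (u + t • d), d⟫ - ⟪g' u, d⟫ - L * t * ‖d‖ ^ 2) t := by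
    intro t
    have hline : HasDerivAt (fun t : ℝ ↦ u + t • d) d t := by
      simpa using ((hasDerivAt_id t).smul_const d).const_add u
    have hcomp : HasDerivAt (fun t : ℝ ↦ g (u + t • d)) ⟪g' (u + t • d), d⟫ t := by
      exact (hdiff (u + t • d)).hasFDerivAt.comp_hasDerivAt t hline
    have hlin : HasDerivAt (fun t : ℝ ↦ t * ⟪g' u, d⟫) ⟪g' u, d⟫ t := by
      simpa using (hasDerivAt_id t).mul_const ⟪g' u, d⟫
    have hquad : HasDerivAt (fun t : ℝ ↦ L / 2 * t ^ 2 * ‖d‖ ^ 2) (L * t * ‖d‖ ^ 2) t := by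
      refine (((hasDerivAt_pow 2 t).const_mul (L / 2)).mul_const (‖d‖ ^ 2)).congr_deriv ?_
      push_cast
      ring
    exact (hcomp.sub hlin).sub hquad
  have hanti : AntitoneOn F (Set.Icc 0 1) := by
    refine antitoneOn_of_deriv_nonpos (convex_Icc 0 1)
      (fun t _ ↦ (hF t).continuousAt.continuousWithinAt)
      (fun t _ ↦ (hF t).differentiableAt.differentiableWithinAt) fun t ht ↦ ?_
    rw [interior_Icc] at ht
    rw [(hF t).deriv, ← inner_sub_left]
    have hlip := hsmooth (u + t • d) u
    rw [add_sub_cancel_left, norm_smul, Real.norm_of_nonneg ht.1.le] at hlip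
    have hcs := real_inner_le_norm (g' (u + t • d) - g' u) d
    nlinarith [mul_le_mul_of_nonneg_right hlip (norm_nonneg d)]
  have hle := hanti (Set.left_mem_Icc.2 zero_le_one) (Set.right_mem_Icc.2 zero_le_one) zero_le_one
  have huv : u + d = v := by rw [hd]; abel
  simp only [F, one_smul, zero_smul, add_zero, huv] at hle
  linarith

/-- Cocoercivity of the gradient of a smooth strongly convex function. -/
lemma norm_sq_gradient_sub_add_le (hμL : μ ≤ L) (hdiff : ∀ u, HasGradientAt g (g' u) u)
    (hsmooth : ∀ u v, ‖g' u - g' v‖ ≤ L * ‖u - v‖)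
    (hsc : ∀ u v, g v ≥ g u + ⟪g' u, v - u⟫ + μ / 2 * ‖v - u‖ ^ 2) (u v : E) :
    ‖g' u - g' v‖ ^ 2 + L * μ * ‖u - v‖ ^ 2 ≤ (L + μ) * ⟪g' u - g' v, u - v⟫ := by
  set d := u - v with hd
  set Δ := g' u - g' v with hΔ
  rcases hμL.eq_or_lt with rfl | hlt
  · have h₁ := hsc u v
    have h₂ := hsc v u
    have h₃ : μ * ‖d‖ ^ 2 ≤ ⟪Δ, d⟫ := by
      rw [← neg_sub u v, ← hd, norm_neg, inner_neg_right] at h₁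
      rw [← hd] at h₂
      rw [hΔ, inner_sub_left]
      linarith
    have h₄ : ‖Δ‖ ≤ μ * ‖d‖ := hsmooth u v
    have h₅ : ‖Δ‖ ^ 2 ≤ (μ * ‖d‖) ^ 2 := by gcongr
    rcases le_or_gt 0 μ with h0 | h0
    · nlinarith
    · have hd0 : ‖d‖ = 0 := by nlinarith [norm_nonneg d, norm_nonneg Δ]
      have hd1 : d = 0 := norm_eq_zero.1 hd0
      rw [hd0] at h₅
      rw [hd1, inner_zero_right, norm_zero]
      linarith
  · have key : ∀ a b : E, ‖g' a - g' b - μ • (a - b)‖ ^ 2 ≤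
        2 * (L - μ) * (g a - g b - ⟪g' b, a - b⟫ - μ / 2 * ‖a - b‖ ^ 2) := by
      intro a b
      set D := g' a - g' b - μ • (a - b) with hD
      set t := (L - μ)⁻¹ with ht
      have hlow := hsc b (a - t • D)
      have hupp := le_quadratic_of_lipschitz_gradient hdiff hsmooth a (a - t • D)
      have e₁ : a - t • D - b = (a - b) - t • D := by abel
      have e₂ : a - t • D - a = -(t • D) := by abel
      rw [e₁, norm_sub_sq_real, inner_sub_right, inner_smul_right, inner_smul_right, norm_smul,
        mul_pow, Real.norm_eq_abs, sq_abs] at hlow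
      rw [e₂, norm_neg, inner_neg_right, inner_smul_right, norm_smul,
        mul_pow, Real.norm_eq_abs, sq_abs] at hupp
      have hDD : ‖D‖ ^ 2 = ⟪g' a, D⟫ - ⟪g' b, D⟫ - μ * ⟪a - b, D⟫ := by
        rw [← real_inner_self_eq_norm_sq]
        nth_rewrite 1 [hD]
        rw [inner_sub_left, inner_sub_left, real_inner_smul_left]
      have hpos : 0 < L - μ := sub_pos.2 hlt
      have htL : (L - μ) * t = 1 := mul_inv_cancel₀ hpos.ne'
      have hmain : t * ‖D‖ ^ 2 - (L - μ) / 2 * (t ^ 2 * ‖D‖ ^ 2) ≤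
          g a - g b - ⟪g' b, a - b⟫ - μ / 2 * ‖a - b‖ ^ 2 := by
        have := congrArg (t * ·) hDD
        linarith
      calc ‖D‖ ^ 2 = 2 * (L - μ) * (t * ‖D‖ ^ 2 - (L - μ) / 2 * (t ^ 2 * ‖D‖ ^ 2)) := by
            linear_combination (‖D‖ ^ 2 * ((L - μ) * t - 1)) * htL
        _ ≤ _ := by gcongr
    have h₁ := key u v
    have h₂ := key v u
    have e : g' v - g' u - μ • (v - u) = -(Δ - μ • d) := by
      rw [hΔ, hd]; module
    rw [e, norm_neg, ← neg_sub u v, ← hd, norm_neg, inner_neg_right] at h₂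
    rw [← hd, ← hΔ] at h₁
    rw [norm_sub_sq_real, inner_smul_right, norm_smul, mul_pow, Real.norm_eq_abs, sq_abs] at h₁ h₂
    have e₂ : ⟪Δ, d⟫ = ⟪g' u, d⟫ - ⟪g' v, d⟫ := by rw [hΔ, inner_sub_left]
    have e₃ := congrArg ((L - μ) * ·) e₂
    linarith

/-- With step size `1 / √(L * μ)`, written as `1 / (s * μ)` where `L = s ^ 2 * μ`, the reflected
resolvent of the gradient is a contraction with factor `(s - 1) / (s + 1)`. -/
lemma norm_sq_reflection_le {s : ℝ} (hμ : 0 < μ) (hs : 1 ≤ s) (hL : L = s ^ 2 * μ)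
    (hdiff : ∀ u, HasGradientAt g (g' u) u) (hsmooth : ∀ u v, ‖g' u - g' v‖ ≤ L * ‖u - v‖)
    (hsc : ∀ u v, g v ≥ g u + ⟪g' u, v - u⟫ + μ / 2 * ‖v - u‖ ^ 2) (u v : E) :
    ‖(u - v) - (1 / (s * μ)) • (g' u - g' v)‖ ^ 2 ≤
      ((s - 1) / (s + 1)) ^ 2 * ‖(u - v) + (1 / (s * μ)) • (g' u - g' v)‖ ^ 2 := by
  have hμL : μ ≤ L := by rw [hL]; exact le_mul_of_one_le_left hμ.le (one_le_pow₀ hs)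
  have hco := norm_sq_gradient_sub_add_le hμL hdiff hsmooth hsc u v
  generalize u - v = d at hco ⊢
  generalize g' u - g' v = Δ at hco ⊢
  rw [hL] at hco
  rw [norm_sub_sq_real, norm_add_sq_real, inner_smul_right, norm_smul, mul_pow, Real.norm_eq_abs,
    sq_abs, real_inner_comm Δ d]
  have hs1 : 0 < s + 1 := by linarith
  have hs0 : 0 < s := by linarith
  rw [← sub_nonneg]
  have : 0 ≤ 4 / (s * μ ^ 2 * (s + 1) ^ 2) * ((s ^ 2 * μ + μ) * ⟪Δ, d⟫ -
      (‖Δ‖ ^ 2 + s ^ 2 * μ * μ * ‖d‖ ^ 2)) :=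
    mul_nonneg (by positivity) (sub_nonneg.2 hco)
  refine this.trans_eq ?_
  field_simp
  ring

/-- The gradient vanishes at the minimum of `g + ψ`. -/
lemma gradient_add_eq_zero_of_forall_le {ψ : E → ℝ} {p m : E} (hdiff : HasGradientAt g (g' m) m)
    (hψ : HasGradientAt ψ p m) (hmin : ∀ u, g m + ψ m ≤ g u + ψ u) : g' m + p = 0 := by
  have hsum : HasFDerivAt (fun u ↦ g u + ψ u)
      (InnerProductSpace.toDual ℝ E (g' m) + InnerProductSpace.toDual ℝ E p) m :=
    hdiff.hasFDerivAt.add hψ.hasFDerivAt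
  have hloc : IsLocalMin (fun u ↦ g u + ψ u) m := Filter.Eventually.of_forall hmin
  have h0 := hloc.hasFDerivAt_eq_zero hsum
  rwa [← map_add, map_eq_zero_iff _ (InnerProductSpace.toDual ℝ E).injective] at h0

lemma hasGradientAt_norm_sub_sq (c : ℝ) (z m : E) :
    HasGradientAt (fun u ↦ c / 2 * ‖u - z‖ ^ 2) (c • (m - z)) m := by
  rw [hasGradientAt_iff_hasFDerivAt]
  have h := (((hasFDerivAt_id (𝕜 := ℝ) m).sub_const z).norm_sq).const_mul (c / 2)
  refine h.congr_fderiv ?_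
  ext v
  simp
  ring

lemma hasGradientAt_inner_const (c m : E) : HasGradientAt (fun u ↦ ⟪u, c⟫) c m := by
  rw [hasGradientAt_iff_hasFDerivAt]
  refine ((InnerProductSpace.toDual ℝ E c).hasFDerivAt (x := m)).congr_of_eventuallyEq ?_
  exact Filter.Eventually.of_forall fun u ↦ by simp [real_inner_comm]

/-- An inexact proximal point is close to an exact one. -/
lemma exists_exact_prox [FiniteDimensional ℝ E] {c ε : ℝ} (hc : 0 < c) (hμ : 0 < μ)
    (hdiff : ∀ u, HasGradientAt g (g' u) u)
    (hsc : ∀ u v, g v ≥ g u + ⟪g' u, v - u⟫ + μ / 2 * ‖v - u‖ ^ 2) (z ut : E)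
    (hut : ∀ u, g ut + c / 2 * ‖ut - z‖ ^ 2 ≤ g u + c / 2 * ‖u - z‖ ^ 2 + ε) :
    ∃ m, g' m + c • (m - z) = 0 ∧ (μ + c) / 2 * ‖ut - m‖ ^ 2 ≤ ε := by
  have quad : ∀ u v, g u + c / 2 * ‖u - z‖ ^ 2 + ⟪g' u + c • (u - z), v - u⟫ +
      (μ + c) / 2 * ‖v - u‖ ^ 2 ≤ g v + c / 2 * ‖v - z‖ ^ 2 := by
    intro u v
    have h₁ := hsc u v
    have e : v - z = (u - z) + (v - u) := by abel
    rw [e, norm_add_sq_real, inner_add_left, real_inner_smul_left]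
    linarith
  have hcont : Continuous fun u ↦ g u + c / 2 * ‖u - z‖ ^ 2 := by
    have : Continuous g := continuous_iff_continuousAt.2 fun u ↦ (hdiff u).hasFDerivAt.continuousAt
    fun_prop
  obtain ⟨m, hm⟩ := hcont.exists_forall_le' z <| by
    have hfar := tendsto_norm_cocompact_atTop (E := E) |>.eventually_ge_atTop
      (‖z‖ + 2 * ‖g' z‖ / (μ + c))
    filter_upwards [hfar] with v hv
    have h₁ := quad z v
    have h₂ : 2 * ‖g' z‖ / (μ + c) ≤ ‖v - z‖ := by linarith [norm_sub_norm_le v z]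
    rw [div_le_iff₀ (by positivity)] at h₂
    have h₃ := neg_le_of_abs_le (abs_real_inner_le_norm (g' z) (v - z))
    rw [sub_self, smul_zero, add_zero] at h₁
    rw [sub_self]
    nlinarith [norm_nonneg (v - z)]
  have hgrad := gradient_add_eq_zero_of_forall_le (hdiff m) (hasGradientAt_norm_sub_sq c z m) hm
  refine ⟨m, hgrad, ?_⟩
  have h₁ := quad m ut
  rw [hgrad, inner_zero_left] at h₁
  linarith [hut m]

/-- One inexact reflected proximal step, followed by a perturbation `f`. -/
lemma norm_sq_inexact_reflection_add_le [FiniteDimensional ℝ E] {s ε : ℝ} (hμ : 0 < μ)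
    (hs : 1 ≤ s) (hL : L = s ^ 2 * μ) (hdiff : ∀ u, HasGradientAt g (g' u) u)
    (hsmooth : ∀ u v, ‖g' u - g' v‖ ≤ L * ‖u - v‖)
    (hsc : ∀ u v, g v ≥ g u + ⟪g' u, v - u⟫ + μ / 2 * ‖v - u‖ ^ 2) (z ut us f : E)
    (hut : ∀ u, g ut + s * μ / 2 * ‖ut - z‖ ^ 2 ≤ g u + s * μ / 2 * ‖u - z‖ ^ 2 + ε) :
    ‖((2 : ℝ) • ut - z) - (us - (1 / (s * μ)) • g' us) + f‖ ^ 2 ≤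
      (s - 1) / (s + 1) * ‖z - (us + (1 / (s * μ)) • g' us)‖ ^ 2 +
        (8 * ε / μ + (s + 1) * ‖f‖ ^ 2) := by
  have hs0 : 0 < s := by linarith
  have hs1 : 0 < s + 1 := by linarith
  obtain ⟨m, hm, hme⟩ := exists_exact_prox (mul_pos hs0 hμ) hμ hdiff hsc z ut hut
  have hz : z = m + (1 / (s * μ)) • g' m := by
    have h₁ : g' m = (s * μ) • (z - m) := by
      rw [eq_neg_of_add_eq_zero_left hm]; module
    rw [h₁, smul_smul, one_div, inv_mul_cancel₀ (by positivity), one_smul]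
    abel
  have hrefl := norm_sq_reflection_le hμ hs hL hdiff hsmooth hsc m us
  set q := (s - 1) / (s + 1) with hq
  have hq0 : 0 ≤ q := div_nonneg (by linarith) hs1.le
  set a := (m - us) - (1 / (s * μ)) • (g' m - g' us) with ha
  set p := (m - us) + (1 / (s * μ)) • (g' m - g' us) with hp
  set b := (2 : ℝ) • (ut - m) + f with hb
  have e₁ : ((2 : ℝ) • ut - z) - (us - (1 / (s * μ)) • g' us) + f = a + b := by
    rw [ha, hb, hz]; module
  have e₂ : z - (us + (1 / (s * μ)) • g' us) = p := by rw [hp, hz]; module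
  rw [e₁, e₂]
  have hap : ‖a‖ ≤ q * ‖p‖ := by
    refine le_of_sq_le_sq ?_ (by positivity)
    rwa [mul_pow]
  have hbb : ‖b‖ ^ 2 ≤ 8 * ‖ut - m‖ ^ 2 + 2 * ‖f‖ ^ 2 := by
    have h₁ := norm_add_le ((2 : ℝ) • (ut - m)) f
    rw [norm_smul, Real.norm_two, ← hb] at h₁
    have h₂ : ‖b‖ ^ 2 ≤ (2 * ‖ut - m‖ + ‖f‖) ^ 2 := by gcongr
    linarith [sq_nonneg (2 * ‖ut - m‖ - ‖f‖)]
  have hyoung : ‖a + b‖ ^ 2 ≤ q * ‖p‖ ^ 2 + (s + 1) / 2 * ‖b‖ ^ 2 := by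
    have h₁ : ‖a + b‖ ^ 2 ≤ (q * ‖p‖ + ‖b‖) ^ 2 := by
      gcongr
      exact (norm_add_le a b).trans (by gcongr)
    refine h₁.trans (sub_nonneg.1 ?_)
    have : 0 ≤ (s - 1) / 2 * (2 / (s + 1) * ‖p‖ - ‖b‖) ^ 2 :=
      mul_nonneg (by linarith) (sq_nonneg _)
    refine this.trans_eq ?_
    rw [hq]
    field_simp
    ring
  have hut' : (s + 1) * ‖ut - m‖ ^ 2 * 4 ≤ 8 * ε / μ := by
    rw [le_div_iff₀ hμ]
    linarith
  nlinarith [mul_le_mul_of_nonneg_left hbb hs1.le]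

end SmoothStronglyConvex

section SkewCoupling

variable {E F : Type*} [NormedAddCommGroup E] [InnerProductSpace ℝ E] [CompleteSpace E]
  [NormedAddCommGroup F] [InnerProductSpace ℝ F] [CompleteSpace F]

/-- The skew coupling `(x, y) ↦ (A y, -A† x)` is orthogonal to the identity. -/
lemma norm_sq_add_skew (A : F →L[ℝ] E) (α : ℝ) (x : E) (y : F) :
    ‖x + α • A y‖ ^ 2 + ‖y - α • ContinuousLinearMap.adjoint A x‖ ^ 2 =
      ‖x‖ ^ 2 + ‖y‖ ^ 2 + α ^ 2 * (‖A y‖ ^ 2 + ‖ContinuousLinearMap.adjoint A x‖ ^ 2) := by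
  rw [norm_add_sq_real, norm_sub_sq_real, inner_smul_right, inner_smul_right, norm_smul, norm_smul,
    mul_pow, mul_pow, Real.norm_eq_abs, sq_abs, ContinuousLinearMap.adjoint_inner_right,
    real_inner_comm x]
  ring

lemma norm_sq_sub_skew (A : F →L[ℝ] E) (α : ℝ) (x : E) (y : F) :
    ‖x - α • A y‖ ^ 2 + ‖y + α • ContinuousLinearMap.adjoint A x‖ ^ 2 =
      ‖x + α • A y‖ ^ 2 + ‖y - α • ContinuousLinearMap.adjoint A x‖ ^ 2 := by
  have h := norm_sq_add_skew A (-α) x y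
  rw [neg_smul, neg_smul, sub_neg_eq_add, ← sub_eq_add_neg, neg_sq] at h
  rw [h, norm_sq_add_skew]

lemma norm_sq_add_skew_le (A : F →L[ℝ] E) (α : ℝ) (x : E) (y : F) :
    ‖x + α • A y‖ ^ 2 + ‖y - α • ContinuousLinearMap.adjoint A x‖ ^ 2 ≤
      (1 + α ^ 2 * ‖A‖ ^ 2) * (‖x‖ ^ 2 + ‖y‖ ^ 2) := by
  have h₁ : ‖A y‖ ^ 2 ≤ ‖A‖ ^ 2 * ‖y‖ ^ 2 := by
    rw [← mul_pow]; gcongr; exact A.le_opNorm y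
  have h₂ : ‖ContinuousLinearMap.adjoint A x‖ ^ 2 ≤ ‖A‖ ^ 2 * ‖x‖ ^ 2 := by
    rw [← mul_pow, ← LinearIsometryEquiv.norm_map ContinuousLinearMap.adjoint A]
    gcongr
    exact ContinuousLinearMap.le_opNorm _ x
  rw [norm_sq_add_skew]
  nlinarith [mul_le_mul_of_nonneg_left (add_le_add h₁ h₂) (sq_nonneg α)]

end SkewCoupling

/-- A linear recurrence with contraction factor `(s - 1) / (s + 1)` and a forcing term decaying
like `(1 - 1 / (2 * s)) ^ k`. -/
lemma le_geometric_of_forced_contraction {V : ℕ → ℝ} {s c a : ℝ} (hs : 1 ≤ s) (hc : 0 ≤ c)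
    (ha : 0 ≤ a) (h0 : V 0 ≤ a * c)
    (hV : ∀ k, V (k + 1) ≤
      (s - 1) / (s + 1) * V k + 3 / 2 * c * (1 - 1 / (2 * s)) ^ (k + 2)) (k : ℕ) :
    V k ≤ (4 * s + a) * (1 - 1 / (2 * s)) ^ k * c := by
  have hs0 : 0 < s := by linarith
  have hs1 : 0 < s + 1 := by linarith
  set r := 1 - 1 / (2 * s) with hr
  set q := (s - 1) / (s + 1) with hq
  have hq0 : 0 ≤ q := div_nonneg (by linarith) hs1.le
  have hr1 : r ≤ 1 := by rw [hr]; linarith [show 0 ≤ 1 / (2 * s) by positivity]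
  have hr0 : 0 ≤ r := by
    rw [hr, sub_nonneg, div_le_one (by positivity)]; linarith
  have hgap : 2 ≤ 4 * s * (r - q) := by
    have : 4 * s * (r - q) = 2 * (3 * s - 1) / (s + 1) := by
      rw [hr, hq]; field_simp; ring
    rw [this, le_div_iff₀ hs1]
    linarith
  have hqr : q ≤ r := by nlinarith
  have hstep : q * (4 * s + a) + 3 / 2 * r ^ 2 ≤ (4 * s + a) * r := by
    nlinarith [mul_nonneg ha (sub_nonneg.2 hqr), pow_le_one₀ hr0 hr1 (n := 2)]
  induction k with
  | zero =>
    rw [pow_zero, mul_one]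
    nlinarith
  | succ k ih =>
    calc V (k + 1) ≤ q * V k + 3 / 2 * c * r ^ (k + 2) := hV k
      _ ≤ q * ((4 * s + a) * r ^ k * c) + 3 / 2 * c * r ^ (k + 2) := by gcongr
      _ = (q * (4 * s + a) + 3 / 2 * r ^ 2) * (r ^ k * c) := by ring
      _ ≤ (4 * s + a) * r * (r ^ k * c) := by gcongr
      _ = (4 * s + a) * r ^ (k + 1) * c := by ring

/-- outer-loop convergence of DIPPA, Theorem 5 of the paper.
With `g, h` `L`-smooth and `μ`-strongly convex (`0 < μ ≤ L`), `(x*, y*)` the saddle point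
of `f(x,y) = g(x) + ⟪x, Ay⟫ − h(y)`, `α = 1/√(Lμ)`, `κ = L/μ`, `ρ = 1/(2√κ)`,
`C₀ = ‖x₀ − x*‖² + ‖y₀ − y*‖²`, `ε_k = (C₀μ/16)(1 − ρ)^{k+1}`,
`δ_k = C₀Lμ(1 − ρ)^{k+1}/(2(1 + √κ)(Lμ + ‖A‖²))`, `C = 4√κ + 1 + ‖A‖²/(Lμ)`,
the DIPPA iterates with `ε_k`-inexact proximal steps on `g, h` and `δ_k`-inexact
solution of the quadratic coupled subproblem satisfy, for every `K ≥ 1`,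
`‖x_K − x*‖² + ‖y_K − y*‖² ≤ C(1 − ρ)^K C₀`. -/
theorem stmt_11 {dx dy : ℕ}
    (g : EuclideanSpace ℝ (Fin dx) → ℝ) (h : EuclideanSpace ℝ (Fin dy) → ℝ)
    (g' : EuclideanSpace ℝ (Fin dx) → EuclideanSpace ℝ (Fin dx))
    (h' : EuclideanSpace ℝ (Fin dy) → EuclideanSpace ℝ (Fin dy))
    (L μ : ℝ) (hμ : 0 < μ) (hμL : μ ≤ L)
    (hgdiff : ∀ u, HasGradientAt g (g' u) u) (hhdiff : ∀ v, HasGradientAt h (h' v) v)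
    (hgsmooth : ∀ u₁ u₂, ‖g' u₁ - g' u₂‖ ≤ L * ‖u₁ - u₂‖)
    (hhsmooth : ∀ v₁ v₂, ‖h' v₁ - h' v₂‖ ≤ L * ‖v₁ - v₂‖)
    (hgsc : ∀ u₁ u₂, g u₂ ≥ g u₁ + ⟪g' u₁, u₂ - u₁⟫ + μ / 2 * ‖u₂ - u₁‖ ^ 2)
    (hhsc : ∀ v₁ v₂, h v₂ ≥ h v₁ + ⟪h' v₁, v₂ - v₁⟫ + μ / 2 * ‖v₂ - v₁‖ ^ 2)
    (A : EuclideanSpace ℝ (Fin dy) →L[ℝ] EuclideanSpace ℝ (Fin dx))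
    (xs : EuclideanSpace ℝ (Fin dx)) (ys : EuclideanSpace ℝ (Fin dy))
    (hsaddle : ∀ (x : EuclideanSpace ℝ (Fin dx)) (y : EuclideanSpace ℝ (Fin dy)),
      g xs + ⟪xs, A y⟫ - h y ≤ g xs + ⟪xs, A ys⟫ - h ys ∧
      g xs + ⟪xs, A ys⟫ - h ys ≤ g x + ⟪x, A ys⟫ - h ys)
    (x xt : ℕ → EuclideanSpace ℝ (Fin dx)) (y yt : ℕ → EuclideanSpace ℝ (Fin dy))
    (z : ℕ → EuclideanSpace ℝ (Fin dx)) (w : ℕ → EuclideanSpace ℝ (Fin dy))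
    (xks : ℕ → EuclideanSpace ℝ (Fin dx)) (yks : ℕ → EuclideanSpace ℝ (Fin dy))
    (α κ ρ C₀ C : ℝ) (ε δ : ℕ → ℝ)
    (hα : α = 1 / Real.sqrt (L * μ)) (hκ : κ = L / μ)
    (hρ : ρ = 1 / (2 * Real.sqrt κ))
    (hC₀ : C₀ = ‖x 0 - xs‖ ^ 2 + ‖y 0 - ys‖ ^ 2)
    (hε : ∀ k : ℕ, ε k = C₀ * μ / 16 * (1 - ρ) ^ (k + 1))
    (hδ : ∀ k : ℕ, δ k =
      C₀ * L * μ * (1 - ρ) ^ (k + 1) / (2 * (1 + Real.sqrt κ) * (L * μ + ‖A‖ ^ 2)))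
    (hC : C = 4 * Real.sqrt κ + 1 + ‖A‖ ^ 2 / (L * μ))
    (hz : ∀ k : ℕ, z (k + 1) = x k - α • A (y k))
    (hw : ∀ k : ℕ, w (k + 1) = y k + α • (ContinuousLinearMap.adjoint A) (x k))
    (hxt : ∀ (k : ℕ) (u : EuclideanSpace ℝ (Fin dx)),
      g (xt (k + 1)) + 1 / (2 * α) * ‖xt (k + 1) - z (k + 1)‖ ^ 2 ≤
        g u + 1 / (2 * α) * ‖u - z (k + 1)‖ ^ 2 + ε (k + 1))
    (hyt : ∀ (k : ℕ) (v : EuclideanSpace ℝ (Fin dy)),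
      h (yt (k + 1)) + 1 / (2 * α) * ‖yt (k + 1) - w (k + 1)‖ ^ 2 ≤
        h v + 1 / (2 * α) * ‖v - w (k + 1)‖ ^ 2 + ε (k + 1))
    (hxks : ∀ k : ℕ,
      xks (k + 1) + α • A (yks (k + 1)) = (2 : ℝ) • xt (k + 1) - z (k + 1))
    (hyks : ∀ k : ℕ,
      yks (k + 1) - α • (ContinuousLinearMap.adjoint A) (xks (k + 1)) =
        (2 : ℝ) • yt (k + 1) - w (k + 1))
    (hxy : ∀ k : ℕ,
      ‖x (k + 1) - xks (k + 1)‖ ^ 2 + ‖y (k + 1) - yks (k + 1)‖ ^ 2 ≤ δ (k + 1)) :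
    ∀ K : ℕ, 1 ≤ K →
      ‖x K - xs‖ ^ 2 + ‖y K - ys‖ ^ 2 ≤ C * (1 - ρ) ^ K * C₀ := by
  set s := Real.sqrt κ with hs_def
  have hκ1 : 1 ≤ κ := by rw [hκ, le_div_iff₀ hμ]; linarith
  have hs : 1 ≤ s := Real.one_le_sqrt.2 hκ1
  have hs0 : 0 < s := by linarith
  have hL : L = s ^ 2 * μ := by
    rw [hs_def, Real.sq_sqrt (by linarith), hκ, div_mul_cancel₀ _ hμ.ne']
  have hα' : α = 1 / (s * μ) := by
    rw [hα, hL, show s ^ 2 * μ * μ = (s * μ) ^ 2 by ring, Real.sqrt_sq (by positivity)]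
  have hcoef : 1 / (2 * α) = s * μ / 2 := by rw [hα']; field_simp
  have hgs : g' xs = -A ys := eq_neg_of_add_eq_zero_left <|
    gradient_add_eq_zero_of_forall_le (hgdiff xs) (hasGradientAt_inner_const (A ys) xs)
      fun u ↦ by linarith [(hsaddle u ys).2]
  have hhs : h' ys = ContinuousLinearMap.adjoint A xs := by
    have := gradient_add_eq_zero_of_forall_le (hhdiff ys)
      (hasGradientAt_inner_const (-ContinuousLinearMap.adjoint A xs) ys) fun v ↦ by
        have := (hsaddle xs v).1
        rw [inner_neg_right, inner_neg_right, ContinuousLinearMap.adjoint_inner_right,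
          ContinuousLinearMap.adjoint_inner_right, real_inner_comm xs, real_inner_comm xs]
        linarith
    exact sub_eq_zero.1 (by rwa [sub_eq_add_neg])
  let V : ℕ → ℝ := fun k ↦ ‖(x k - xs) + α • A (y k - ys)‖ ^ 2 +
    ‖(y k - ys) - α • ContinuousLinearMap.adjoint A (x k - xs)‖ ^ 2
  have hlow : ∀ k, ‖x k - xs‖ ^ 2 + ‖y k - ys‖ ^ 2 ≤ V k := fun k ↦ by
    simp only [V, norm_sq_add_skew]
    linarith [show 0 ≤ α ^ 2 * (‖A (y k - ys)‖ ^ 2 +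
      ‖ContinuousLinearMap.adjoint A (x k - xs)‖ ^ 2) by positivity]
  have hα2 : 1 + α ^ 2 * ‖A‖ ^ 2 = 1 + ‖A‖ ^ 2 / (L * μ) := by
    rw [hα', hL]; field_simp
  have hC₀0 : 0 ≤ C₀ := by rw [hC₀]; positivity
  have hV0 : V 0 ≤ (1 + ‖A‖ ^ 2 / (L * μ)) * C₀ := by
    rw [← hα2, hC₀]
    exact norm_sq_add_skew_le A α _ _
  have hV : ∀ k, V (k + 1) ≤
      (s - 1) / (s + 1) * V k + 3 / 2 * C₀ * (1 - 1 / (2 * s)) ^ (k + 2) := by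
    intro k
    set fx := x (k + 1) - xks (k + 1) with hfx
    set fy := y (k + 1) - yks (k + 1) with hfy
    have hX := norm_sq_inexact_reflection_add_le hμ hs hL hgdiff hgsmooth hgsc (z (k + 1))
      (xt (k + 1)) xs (fx + α • A fy) fun u ↦ by simpa only [hcoef] using hxt k u
    have hY := norm_sq_inexact_reflection_add_le hμ hs hL hhdiff hhsmooth hhsc (w (k + 1))
      (yt (k + 1)) ys (fy - α • ContinuousLinearMap.adjoint A fx) fun v ↦ by
        simpa only [hcoef] using hyt k v
    rw [← hα', hgs, ← hxks k, hz k] at hX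
    rw [← hα', hhs, ← hyks k, hw k] at hY
    have eX₁ : xks (k + 1) + α • A (yks (k + 1)) - (xs - α • -A ys) + (fx + α • A fy) =
        (x (k + 1) - xs) + α • A (y (k + 1) - ys) := by
      rw [hfx, hfy, map_sub, map_sub]; module
    have eX₂ : x k - α • A (y k) - (xs + α • -A ys) = (x k - xs) - α • A (y k - ys) := by
      rw [map_sub]; module
    have eY₁ : yks (k + 1) - α • ContinuousLinearMap.adjoint A (xks (k + 1)) -
        (ys - α • ContinuousLinearMap.adjoint A xs) +
          (fy - α • ContinuousLinearMap.adjoint A fx) =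
        (y (k + 1) - ys) - α • ContinuousLinearMap.adjoint A (x (k + 1) - xs) := by
      rw [hfx, hfy, map_sub, map_sub]; module
    have eY₂ : y k + α • ContinuousLinearMap.adjoint A (x k) -
        (ys + α • ContinuousLinearMap.adjoint A xs) =
        (y k - ys) + α • ContinuousLinearMap.adjoint A (x k - xs) := by
      rw [map_sub]; module
    rw [eX₁, eX₂] at hX
    rw [eY₁, eY₂] at hY
    have hskew := norm_sq_sub_skew A α (x k - xs) (y k - ys)
    have hf := norm_sq_add_skew_le A α fx fy
    have hfδ : (s + 1) * ((1 + α ^ 2 * ‖A‖ ^ 2) * (‖fx‖ ^ 2 + ‖fy‖ ^ 2)) ≤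
        C₀ * (1 - ρ) ^ (k + 2) / 2 := by
      calc _ ≤ (s + 1) * ((1 + α ^ 2 * ‖A‖ ^ 2) * δ (k + 1)) := by gcongr; exact hxy k
        _ = _ := by
          have hLμ : 0 < L * μ := mul_pos (hμ.trans_le hμL) hμ
          have hμ' := hμ.trans_le hμL
          rw [hα2, hδ]
          field_simp
          ring
    have hε' : 8 * ε (k + 1) / μ = C₀ * (1 - ρ) ^ (k + 2) / 2 := by
      rw [hε]; field_simp; ring
    rw [hε'] at hX hY
    rw [← hρ]
    have hsum := congrArg ((s - 1) / (s + 1) * ·) hskew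
    have hfs := mul_le_mul_of_nonneg_left hf (by linarith : 0 ≤ s + 1)
    simp only [mul_add] at hsum hfs
    simp only [V, mul_add]
    simp only [mul_add] at hX hY hfδ
    linarith
  intro K _
  refine (hlow K).trans ?_
  rw [hC, hρ, add_assoc]
  exact le_geometric_of_forced_contraction hs hC₀0
    (add_nonneg zero_le_one (div_nonneg (sq_nonneg _) (mul_pos (hμ.trans_le hμL) hμ).le)) hV0 hV K
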